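/- arXiv:2109.07619 — 2 statements merged into one kernel-verified Lean document; each statement's English description precedes it below -/
import Mathlib

section
/- Let T be a Laver tree with stem τ, A ⊆ T upwards closed, and suppose the canonical Laver ranking satisfies r_{A,T}(τ) = ∞. Then the derived tree T_A is a Laver tree with stem τ, and no infinite path through T_A meets A. -/
/-- A tree on ω: a set of finite strings closed under initial segments. -/
def IsTree (T : Set (List ℕ)) : Prop := ∀ σ ∈ T, ∀ ρ : List ℕ, ρ <+: σ → ρ ∈ T

/-- A Laver tree with stem `τ`: a tree containing `τ`, all of whose elements are
comparable with `τ`, and in which every node extending `τ` has infinitely many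
immediate children. -/
def IsLaverTree (T : Set (List ℕ)) (τ : List ℕ) : Prop :=
  IsTree T ∧ τ ∈ T ∧ (∀ σ ∈ T, τ <+: σ ∨ σ <+: τ) ∧
    ∀ σ ∈ T, τ <+: σ → {n : ℕ | σ ++ [n] ∈ T}.Infinite

/-- `A` is upwards closed in the tree `T`. -/
def UpClosed (T A : Set (List ℕ)) : Prop :=
  ∀ σ ∈ A, ∀ ρ ∈ T, σ <+: ρ → ρ ∈ A

/-- The successor function on ω₁ ∪ {∞} (with ∞ + 1 = ∞), modelled on `WithTop Ordinal`. -/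
def osucc : WithTop Ordinal → WithTop Ordinal := WithTop.map (· + 1)

/-- An `(A, ω₁ ∪ {∞}, T)` Laver ranking (for a Laver tree `T` with stem `τ`):
`r σ = 0` iff `σ ∈ A`, and for `σ ∉ A`, `r σ` is the liminf over the children
`σ⌢n ∈ T` of `r (σ⌢n) + 1`, i.e. the least `x` such that infinitely many
children satisfy `r (σ⌢n) + 1 ≤ x`. -/
def IsLaverRanking (T A : Set (List ℕ)) (τ : List ℕ)
    (r : List ℕ → WithTop Ordinal) : Prop :=
  ∀ σ ∈ T, τ <+: σ →
    ((r σ = 0 ↔ σ ∈ A) ∧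
      (σ ∉ A → IsLeast {x : WithTop Ordinal |
        {n : ℕ | σ ++ [n] ∈ T ∧ osucc (r (σ ++ [n])) ≤ x}.Infinite} (r σ)))

/-- The derived tree `T_A`, defined recursively: all initial segments of the stem
`τ` are in; a child `σ⌢n ∈ T` of `σ ∈ T_A` (with `σ ⊇ τ`) is in when
`r (σ⌢n) < r σ < ∞` (with `σ ∉ A`), or when `σ ∈ A` (all children), or when
`r (σ⌢n) = r σ = ∞` (with `σ ∉ A`). -/
inductive InDerived (T A : Set (List ℕ)) (τ : List ℕ)
    (r : List ℕ → WithTop Ordinal) : List ℕ → Prop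
  | stem (σ : List ℕ) : σ <+: τ → InDerived T A τ r σ
  | dec (σ : List ℕ) (n : ℕ) : InDerived T A τ r σ → τ <+: σ → σ ∉ A →
      σ ++ [n] ∈ T → r (σ ++ [n]) < r σ → r σ ≠ ⊤ → InDerived T A τ r (σ ++ [n])
  | mem (σ : List ℕ) (n : ℕ) : InDerived T A τ r σ → τ <+: σ → σ ∈ A →
      σ ++ [n] ∈ T → InDerived T A τ r (σ ++ [n])
  | inf (σ : List ℕ) (n : ℕ) : InDerived T A τ r σ → τ <+: σ → σ ∉ A →
      σ ++ [n] ∈ T → r (σ ++ [n]) = ⊤ → r σ = ⊤ → InDerived T A τ r (σ ++ [n])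

/-- The initial segment of length `n` of `f`, as a finite string. -/
def initSeg (f : ℕ → ℕ) (n : ℕ) : List ℕ := List.ofFn fun i : Fin n => f i

section DerivedTree

variable {T A : Set (List ℕ)} {τ σ : List ℕ} {r : List ℕ → WithTop Ordinal}

/-- The derived tree is closed under initial segments. -/
theorem isTree_inDerived : IsTree {σ | InDerived T A τ r σ} := by
  intro σ (hσ : InDerived T A τ r σ)
  induction hσ with
  | stem σ h => exact fun ρ hρ => .stem ρ (hρ.trans h)
  | dec σ n h h1 h2 h3 h4 h5 ih =>
    intro ρ hρ
    rcases List.prefix_concat_iff.1 hρ with rfl | hρ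
    exacts [.dec σ n h h1 h2 h3 h4 h5, ih ρ hρ]
  | mem σ n h h1 h2 h3 ih =>
    intro ρ hρ
    rcases List.prefix_concat_iff.1 hρ with rfl | hρ
    exacts [.mem σ n h h1 h2 h3, ih ρ hρ]
  | inf σ n h h1 h2 h3 h4 h5 ih =>
    intro ρ hρ
    rcases List.prefix_concat_iff.1 hρ with rfl | hρ
    exacts [.inf σ n h h1 h2 h3 h4 h5, ih ρ hρ]

/-- A node of `T` above the stem that has rank `∞` is not in `A`. -/
theorem IsLaverRanking.notMem_of_eq_top (hr : IsLaverRanking T A τ r) (hσ : σ ∈ T)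
    (hτσ : τ <+: σ) (h : r σ = ⊤) : σ ∉ A := by
  intro hA
  have h0 := ((hr σ hσ hτσ).1).2 hA
  exact WithTop.top_ne_zero (h.symm.trans h0)

/-- A node of rank `∞` has infinitely many children of rank `∞`. -/
theorem IsLaverRanking.infinite_children_eq_top (hr : IsLaverRanking T A τ r) (hσ : σ ∈ T)
    (hτσ : τ <+: σ) (h : r σ = ⊤) (hinf : {n : ℕ | σ ++ [n] ∈ T}.Infinite) :
    {n : ℕ | σ ++ [n] ∈ T ∧ r (σ ++ [n]) = ⊤}.Infinite := by
  intro hfin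
  have hleast := (hr σ hσ hτσ).2 (hr.notMem_of_eq_top hσ hτσ h)
  obtain ⟨b, hb⟩ := Ordinal.bddAbove_of_small
    (s := Set.range fun n : ℕ => (r (σ ++ [n])).untopD 0 + 1)
  have hle : r σ ≤ (b : WithTop Ordinal) := by
    refine hleast.2 ((hinf.sdiff hfin).mono ?_)
    rintro n ⟨hn, hne⟩
    refine ⟨hn, ?_⟩
    have hbn : (r (σ ++ [n])).untopD 0 + 1 ≤ b := hb ⟨n, rfl⟩
    obtain ⟨a, ha⟩ := WithTop.ne_top_iff_exists.1 fun htop => hne ⟨hn, htop⟩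
    rw [← ha] at hbn ⊢
    exact WithTop.coe_le_coe.2 hbn
  rw [h, top_le_iff] at hle
  exact WithTop.coe_ne_top hle

/-- If the stem has rank `∞`, so does every node of the derived tree above the stem. -/
theorem InDerived.prefix_or_eq_top (hr : IsLaverRanking T A τ r) (hτT : τ ∈ T) (hτ : r τ = ⊤)
    (hσ : InDerived T A τ r σ) : σ <+: τ ∨ τ <+: σ ∧ σ ∈ T ∧ r σ = ⊤ := by
  have key : ∀ ρ, τ <+: ρ → (ρ <+: τ ∨ τ <+: ρ ∧ ρ ∈ T ∧ r ρ = ⊤) → ρ ∈ T ∧ r ρ = ⊤ := by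
    rintro ρ hτρ (hρ | hρ)
    · obtain rfl := hρ.eq_of_length_le hτρ.length_le
      exact ⟨hτT, hτ⟩
    · exact hρ.2
  induction hσ with
  | stem σ h => exact .inl h
  | dec σ n _ h1 _ _ _ h5 ih => exact absurd (key σ h1 ih).2 h5
  | mem σ n _ h1 h2 _ ih =>
    obtain ⟨hσ, htop⟩ := key σ h1 ih
    exact absurd h2 (hr.notMem_of_eq_top hσ h1 htop)
  | inf σ n _ h1 _ h3 h4 _ _ => exact .inr ⟨h1.trans (List.prefix_append σ [n]), h3, h4⟩

/-- If the stem has rank `∞`, every node of the derived tree above the stem is a node of `T` of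
rank `∞`. -/
theorem InDerived.mem_and_eq_top (hr : IsLaverRanking T A τ r) (hτT : τ ∈ T) (hτ : r τ = ⊤)
    (hσ : InDerived T A τ r σ) (hτσ : τ <+: σ) : σ ∈ T ∧ r σ = ⊤ := by
  rcases hσ.prefix_or_eq_top hr hτT hτ with h | h
  · obtain rfl := h.eq_of_length_le hτσ.length_le
    exact ⟨hτT, hτ⟩
  · exact h.2

/-- If the stem has rank `∞`, the derived tree is disjoint from `A`. -/
theorem InDerived.notMem (hA : UpClosed T A) (hr : IsLaverRanking T A τ r) (hτT : τ ∈ T)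
    (hτ : r τ = ⊤) (hσ : InDerived T A τ r σ) : σ ∉ A := by
  rcases hσ.prefix_or_eq_top hr hτT hτ with h | ⟨hτσ, hσT, htop⟩
  · exact fun hσA => hr.notMem_of_eq_top hτT List.prefix_rfl hτ (hA σ hσA τ hτT h)
  · exact hr.notMem_of_eq_top hσT hτσ htop

end DerivedTree

/-- if `T` is a Laver tree with stem `τ`, `A ⊆ T` is upwards closed,
and the canonical Laver ranking has `r τ = ∞`, then the derived tree `T_A` is a
Laver tree with stem `τ` and no infinite path through `T_A` meets `A`. -/
theorem derived_tree_avoids_A (T A : Set (List ℕ)) (τ : List ℕ)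
    (hT : IsLaverTree T τ) (hAT : A ⊆ T) (hA : UpClosed T A)
    (r : List ℕ → WithTop Ordinal) (hr : IsLaverRanking T A τ r)
    (hτ : r τ = ⊤) :
    IsLaverTree {σ | InDerived T A τ r σ} τ ∧
      ∀ g : ℕ → ℕ, (∀ n, InDerived T A τ r (initSeg g n)) →
        ∀ n, initSeg g n ∉ A := by
  obtain ⟨-, hτT, -, hinf⟩ := hT
  refine ⟨⟨isTree_inDerived, .stem τ List.prefix_rfl, ?_, ?_⟩,
    fun g hg n => (hg n).notMem hA hr hτT hτ⟩
  · intro σ (hσ : InDerived T A τ r σ)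
    exact (hσ.prefix_or_eq_top hr hτT hτ).symm.imp_left And.left
  · intro σ (hσ : InDerived T A τ r σ) hτσ
    obtain ⟨hσT, htop⟩ := hσ.mem_and_eq_top hr hτT hτ hτσ
    refine (hr.infinite_children_eq_top hσT hτσ htop (hinf σ hσT hτσ)).mono ?_
    rintro n ⟨hn, hntop⟩
    exact .inf σ n hσ hτσ (hr.notMem_of_eq_top hσT hτσ htop) hn hntop htop
end

section
/- Let 𝒫 ⊆ ω^ω be a Π⁰₁ class and f ∈ ω^ω such that every function dominating f computes an element of 𝒫. Then there exist a Turing functional Φ and a function f′ such that for every g majorizing f′, Φ^g is total and is an element of 𝒫. -/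
inductive OracleCode : Type
  | zero : OracleCode
  | succ : OracleCode
  | left : OracleCode
  | right : OracleCode
  | oracle : OracleCode
  | pair : OracleCode → OracleCode → OracleCode
  | comp : OracleCode → OracleCode → OracleCode
  | prec : OracleCode → OracleCode → OracleCode
  | rfind' : OracleCode → OracleCode

/-- Evaluation of an oracle code with oracle `O`. -/
def OracleCode.eval (O : ℕ → ℕ) : OracleCode → ℕ →. ℕ
  | .zero => pure 0
  | .succ => fun n => Part.some (n + 1)
  | .left => fun n => Part.some n.unpair.1
  | .right => fun n => Part.some n.unpair.2
  | .oracle => fun n => Part.some (O n)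
  | .pair cf cg => fun n => Nat.pair <$> OracleCode.eval O cf n <*> OracleCode.eval O cg n
  | .comp cf cg => fun n => OracleCode.eval O cg n >>= OracleCode.eval O cf
  | .prec cf cg =>
      Nat.unpaired fun a n =>
        n.rec (OracleCode.eval O cf a) fun y IH => do
          let i ← IH
          OracleCode.eval O cg (Nat.pair a (Nat.pair y i))
  | .rfind' cf =>
      Nat.unpaired fun a m =>
        (Nat.rfind fun n => (fun x => x = 0) <$> OracleCode.eval O cf (Nat.pair a (n + m))).map
          (· + m)

theorem initSeg_succ (f : ℕ → ℕ) (n : ℕ) : initSeg f (n + 1) = initSeg f n ++ [f n] := by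
  rw [initSeg, List.ofFn_succ_last]
  rfl

theorem initSeg_eq_map_range (f : ℕ → ℕ) (n : ℕ) : initSeg f n = (List.range n).map f := by
  induction n with
  | zero => rfl
  | succ n ih => rw [initSeg_succ, ih, List.range_succ]; simp

theorem initSeg_congr {f g : ℕ → ℕ} {n : ℕ} (h : ∀ i < n, f i = g i) :
    initSeg f n = initSeg g n := by
  rw [initSeg_eq_map_range, initSeg_eq_map_range]
  exact List.map_congr_left fun i hi => h i (List.mem_range.1 hi)

@[simp]
theorem mem_ofOption_initSeg {f : ℕ → ℕ} {n i m : ℕ} :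
    m ∈ (((initSeg f n)[i]? : Option ℕ) : Part ℕ) ↔ i < n ∧ f i = m := by
  rw [Part.mem_ofOption, Option.mem_def, initSeg_eq_map_range]
  simp [List.getElem?_eq_some_iff]

namespace OracleCode

/-- Evaluation of an oracle code relative to a partial oracle. -/
def evalPart (p : ℕ → Part ℕ) : OracleCode → ℕ → Part ℕ
  | .zero => fun _ => Part.some 0
  | .succ => fun n => Part.some (n + 1)
  | .left => fun n => Part.some n.unpair.1
  | .right => fun n => Part.some n.unpair.2
  | .oracle => p
  | .pair cf cg => fun n => Nat.pair <$> evalPart p cf n <*> evalPart p cg n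
  | .comp cf cg => fun n => evalPart p cg n >>= evalPart p cf
  | .prec cf cg =>
      Nat.unpaired fun a n =>
        n.rec (evalPart p cf a) fun y IH => do
          let i ← IH
          evalPart p cg (Nat.pair a (Nat.pair y i))
  | .rfind' cf =>
      Nat.unpaired fun a m =>
        (Nat.rfind fun n => (fun x => x = 0) <$> evalPart p cf (Nat.pair a (n + m))).map
          (· + m)

theorem evalPart_coe (O : ℕ → ℕ) (c : OracleCode) :
    evalPart (fun n => Part.some (O n)) c = eval O c := by
  induction c with
  | zero | succ | left | right | oracle => rfl
  | pair cf cg hf hg | comp cf cg hf hg | prec cf cg hf hg =>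
    simp only [evalPart, eval, hf, hg]
  | rfind' cf hf =>
    simp only [evalPart, eval, hf]

section Mem

variable {p : ℕ → Part ℕ} {cf cg : OracleCode} {n m : ℕ}

theorem mem_evalPart_pair : m ∈ evalPart p (pair cf cg) n ↔
    ∃ a ∈ evalPart p cf n, ∃ b ∈ evalPart p cg n, Nat.pair a b = m := by
  change m ∈ ((evalPart p cf n).map Nat.pair).bind
    (fun y => (evalPart p cg n).map y) ↔ _
  simp [Part.mem_bind_iff, Part.mem_map_iff]

theorem mem_evalPart_comp : m ∈ evalPart p (comp cf cg) n ↔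
    ∃ a ∈ evalPart p cg n, m ∈ evalPart p cf a :=
  Part.mem_bind_iff

theorem mem_evalPart_prec_zero {a : ℕ} : m ∈ evalPart p (prec cf cg) (Nat.pair a 0) ↔
    m ∈ evalPart p cf a := by
  simp only [evalPart, Nat.unpaired, Nat.unpair_pair]
  rfl

theorem mem_evalPart_prec_succ {a k : ℕ} :
    m ∈ evalPart p (prec cf cg) (Nat.pair a (k + 1)) ↔
      ∃ i ∈ evalPart p (prec cf cg) (Nat.pair a k),
        m ∈ evalPart p cg (Nat.pair a (Nat.pair k i)) := by
  simp only [evalPart, Nat.unpaired, Nat.unpair_pair]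
  exact Part.mem_bind_iff

theorem mem_evalPart_rfind' : m ∈ evalPart p (rfind' cf) n ↔
    ∃ k, (0 ∈ evalPart p cf (Nat.pair n.unpair.1 (k + n.unpair.2)) ∧
      ∀ i < k, ∃ y ∈ evalPart p cf (Nat.pair n.unpair.1 (i + n.unpair.2)), y ≠ 0) ∧
        k + n.unpair.2 = m := by
  change m ∈ (Nat.rfind fun k => (evalPart p cf (Nat.pair n.unpair.1 (k + n.unpair.2))).map
    fun x => decide (x = 0)).map (· + n.unpair.2) ↔ _
  rw [Part.mem_map_iff]
  refine exists_congr fun k => and_congr_left fun _ => Nat.mem_rfind.trans ?_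
  simp [Part.mem_map_iff]

end Mem

theorem evalPart_mono {p q : ℕ → Part ℕ} (hpq : ∀ n, ∀ m ∈ p n, m ∈ q n) (c : OracleCode) :
    ∀ n, ∀ m ∈ evalPart p c n, m ∈ evalPart q c n := by
  induction c with
  | zero | succ | left | right => exact fun n m h => h
  | oracle => exact hpq
  | pair cf cg hf hg =>
    intro n m h
    rw [mem_evalPart_pair] at h ⊢
    obtain ⟨a, ha, b, hb, rfl⟩ := h
    exact ⟨a, hf _ _ ha, b, hg _ _ hb, rfl⟩
  | comp cf cg hf hg =>
    intro n m h
    rw [mem_evalPart_comp] at h ⊢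
    obtain ⟨a, ha, h⟩ := h
    exact ⟨a, hg _ _ ha, hf _ _ h⟩
  | prec cf cg hf hg =>
    intro n m h
    rw [← Nat.pair_unpair n] at h ⊢
    generalize n.unpair.2 = k at h ⊢
    induction k generalizing m with
    | zero =>
      rw [mem_evalPart_prec_zero] at h ⊢
      exact hf _ _ h
    | succ k ih =>
      rw [mem_evalPart_prec_succ] at h ⊢
      obtain ⟨i, hi, h⟩ := h
      exact ⟨i, ih _ hi, hg _ _ h⟩
  | rfind' cf hf =>
    intro n m h
    rw [mem_evalPart_rfind'] at h ⊢
    obtain ⟨k, ⟨h0, hlt⟩, rfl⟩ := h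
    exact ⟨k, ⟨hf _ _ h0, fun i hi => (hlt i hi).imp fun y hy => ⟨hf _ _ hy.1, hy.2⟩⟩, rfl⟩

/-- Evaluation of an oracle code relative to a finite string. -/
def evalString (l : List ℕ) (c : OracleCode) : ℕ → Part ℕ :=
  evalPart (fun i => (l[i]? : Option ℕ)) c

theorem mem_eval_of_mem_evalString {f : ℕ → ℕ} {K : ℕ} {c : OracleCode} {n m : ℕ}
    (h : m ∈ evalString (initSeg f K) c n) : m ∈ eval f c n := by
  rw [← evalPart_coe]
  refine evalPart_mono (fun i x hx => ?_) c n m h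
  simpa using (mem_ofOption_initSeg.1 hx).2.symm

/-- The use principle: a convergent computation consults only finitely much of its oracle. -/
theorem eventually_mem_evalString (f : ℕ → ℕ) (c : OracleCode) :
    ∀ n, ∀ m ∈ eval f c n, ∀ᶠ K in Filter.atTop, m ∈ evalString (initSeg f K) c n := by
  unfold evalString
  rw [← evalPart_coe]
  induction c with
  | zero | succ | left | right => exact fun n m h => Filter.Eventually.of_forall fun _ => h
  | oracle =>
    intro n m h
    obtain rfl := Part.mem_some_iff.1 h
    filter_upwards [Filter.eventually_gt_atTop n] with K hK
    exact mem_ofOption_initSeg.2 ⟨hK, rfl⟩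
  | pair cf cg hf hg =>
    intro n m h
    simp only [mem_evalPart_pair] at h ⊢
    obtain ⟨a, ha, b, hb, rfl⟩ := h
    filter_upwards [hf _ _ ha, hg _ _ hb] with K ha hb
    exact ⟨a, ha, b, hb, rfl⟩
  | comp cf cg hf hg =>
    intro n m h
    simp only [mem_evalPart_comp] at h ⊢
    obtain ⟨a, ha, h⟩ := h
    filter_upwards [hg _ _ ha, hf _ _ h] with K ha h
    exact ⟨a, ha, h⟩
  | prec cf cg hf hg =>
    intro n m h
    rw [← Nat.pair_unpair n] at h ⊢
    generalize n.unpair.2 = k at h ⊢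
    induction k generalizing m with
    | zero =>
      simp only [mem_evalPart_prec_zero] at h ⊢
      exact hf _ _ h
    | succ k ih =>
      simp only [mem_evalPart_prec_succ] at h ⊢
      obtain ⟨i, hi, h⟩ := h
      filter_upwards [ih _ hi, hg _ _ h] with K hi h
      exact ⟨i, hi, h⟩
  | rfind' cf hf =>
    intro n m h
    simp only [mem_evalPart_rfind'] at h ⊢
    obtain ⟨k, ⟨h0, hlt⟩, rfl⟩ := h
    choose! y hy hy0 using hlt
    filter_upwards [hf _ _ h0, (Filter.eventually_all_finite (Set.finite_lt_nat k)).2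
      fun i hi => hf _ _ (hy i hi)] with K h0 hlt
    exact ⟨k, ⟨h0, fun i hi => ⟨y i, hlt i hi, hy0 i hi⟩⟩, rfl⟩

theorem partrec_evalString (c : OracleCode) :
    Partrec fun a : List ℕ × ℕ => evalString a.1 c a.2 := by
  unfold evalString
  induction c with
  | zero => exact (Computable.const 0).partrec
  | succ => exact (Computable.succ.comp .snd).partrec
  | left => exact (Computable.fst.comp (Computable.unpair.comp .snd)).partrec
  | right => exact (Computable.snd.comp (Computable.unpair.comp .snd)).partrec
  | oracle => exact (Computable.list_getElem?.comp .fst .snd).ofOption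
  | pair cf cg hf hg =>
    refine (hf.bind (g := fun a x => (evalPart (fun i => (a.1[i]? : Option ℕ)) cg a.2).map
      (Nat.pair x)) ?_).of_eq fun a => ?_
    · exact (hg.comp .fst).map (Primrec₂.natPair.to_comp.comp (Computable.snd.comp .fst) .snd)
    · ext m
      simp [mem_evalPart_pair, Part.mem_bind_iff, Part.mem_map_iff]
  | comp cf cg hf hg =>
    exact hg.bind (hf.comp (Computable.pair (Computable.fst.comp .fst) .snd))
  | prec cf cg hf hg =>
    refine (Partrec.nat_rec (Computable.snd.comp (Computable.unpair.comp .snd))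
      (hf.comp (Computable.pair .fst (Computable.fst.comp (Computable.unpair.comp .snd))))
      (h := fun a yi => evalPart (fun i => (a.1[i]? : Option ℕ)) cg
        (Nat.pair a.2.unpair.1 (Nat.pair yi.1 yi.2))) ?_).of_eq fun a => ?_
    · have h1 : Computable fun a : (List ℕ × ℕ) × ℕ × ℕ =>
          Nat.pair a.1.2.unpair.1 (Nat.pair a.2.1 a.2.2) :=
        Primrec₂.natPair.to_comp.comp
          (Computable.fst.comp (Computable.unpair.comp (Computable.snd.comp .fst)))
          (Primrec₂.natPair.to_comp.comp (Computable.fst.comp .snd) (Computable.snd.comp .snd))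
      exact hg.comp (Computable.pair (Computable.fst.comp .fst) h1)
    · simp [evalPart, Nat.unpaired]
  | rfind' cf hf =>
    have h1 : Computable fun a : (List ℕ × ℕ) × ℕ =>
        (a.1.1, Nat.pair a.1.2.unpair.1 (a.2 + a.1.2.unpair.2)) :=
      Computable.pair (Computable.fst.comp .fst) (Primrec₂.natPair.to_comp.comp
        (Computable.fst.comp (Computable.unpair.comp (Computable.snd.comp .fst)))
        (Primrec.nat_add.to_comp.comp .snd
          (Computable.snd.comp (Computable.unpair.comp (Computable.snd.comp .fst)))))
    have h2 : Computable fun x : ℕ => decide (x = 0) :=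
      (Primrec.eq.decide.comp .id (.const 0)).to_comp
    have h3 : Computable fun a : List ℕ × ℕ => a.2.unpair.2 :=
      Computable.snd.comp (Computable.unpair.comp .snd)
    refine ((Partrec.rfind (p := fun (a : List ℕ × ℕ) n =>
        ((evalPart (fun i => (a.1[i]? : Option ℕ)) cf
          (Nat.pair a.2.unpair.1 (n + a.2.unpair.2))).map fun x => decide (x = 0)))
      ?_).map (g := fun a n => n + a.2.unpair.2) ?_).of_eq fun a => ?_
    · exact (hf.comp h1).map (h2.comp .snd)
    · exact Primrec.nat_add.to_comp.comp .snd (h3.comp .fst)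
    · rfl

/-- A numbering of the oracle codes. -/
def toNat : OracleCode → ℕ
  | .zero => Nat.pair 0 0
  | .succ => Nat.pair 1 0
  | .left => Nat.pair 2 0
  | .right => Nat.pair 3 0
  | .oracle => Nat.pair 4 0
  | .pair cf cg => Nat.pair 5 (Nat.pair cf.toNat cg.toNat)
  | .comp cf cg => Nat.pair 6 (Nat.pair cf.toNat cg.toNat)
  | .prec cf cg => Nat.pair 7 (Nat.pair cf.toNat cg.toNat)
  | .rfind' cf => Nat.pair 8 cf.toNat

theorem toNat_injective : Function.Injective toNat := by
  intro a
  induction a <;> intro b h <;> cases b <;> simp_all [toNat, Nat.pair_eq_pair] <;> grind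

instance : Countable OracleCode := toNat_injective.countable

instance : Nonempty OracleCode := ⟨zero⟩

/-- Every code of an oracle-free partial recursive function is an oracle code. -/
def ofCode : Nat.Partrec.Code → OracleCode
  | .zero => .zero
  | .succ => .succ
  | .left => .left
  | .right => .right
  | .pair cf cg => .pair (ofCode cf) (ofCode cg)
  | .comp cf cg => .comp (ofCode cf) (ofCode cg)
  | .prec cf cg => .prec (ofCode cf) (ofCode cg)
  | .rfind' cf => .rfind' (ofCode cf)

theorem eval_ofCode (O : ℕ → ℕ) (c : Nat.Partrec.Code) : eval O (ofCode c) = c.eval := by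
  induction c with
  | zero | succ | left | right => rfl
  | pair cf cg hf hg | comp cf cg hf hg | prec cf cg hf hg =>
    simp only [ofCode, eval, Nat.Partrec.Code.eval, hf, hg]
    rfl
  | rfind' cf hf =>
    simp only [ofCode, eval, Nat.Partrec.Code.eval, hf]
    rfl

end OracleCode

open Encodable

/-- `F` is computable relative to the oracle, by one code that works for all oracles in `S`. -/
def UniformlyComputable {α β : Type*} [Primcodable α] [Primcodable β] (S : Set (ℕ → ℕ))
    (F : (ℕ → ℕ) → α → β) : Prop :=
  ∃ c : OracleCode, ∀ O ∈ S, ∀ a, encode (F O a) ∈ c.eval O (encode a)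

namespace UniformlyComputable

open OracleCode

variable {α β γ : Type*} [Primcodable α] [Primcodable β] [Primcodable γ] {S : Set (ℕ → ℕ)}

theorem of_computable {f : α → β} (hf : Computable f) :
    UniformlyComputable S fun _ => f := by
  obtain ⟨c, hc⟩ := Nat.Partrec.Code.exists_code.1 hf
  refine ⟨ofCode c, fun O _ a => ?_⟩
  rw [eval_ofCode, hc]
  simp

theorem oracle : UniformlyComputable S fun O (n : ℕ) => O n :=
  ⟨.oracle, fun O _ n => Part.mem_some (O n)⟩

theorem comp {G : (ℕ → ℕ) → β → γ} {F : (ℕ → ℕ) → α → β} (hG : UniformlyComputable S G)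
    (hF : UniformlyComputable S F) : UniformlyComputable S fun O a => G O (F O a) := by
  obtain ⟨cG, hG⟩ := hG
  obtain ⟨cF, hF⟩ := hF
  refine ⟨.comp cG cF, fun O hO a => ?_⟩
  simp only [← evalPart_coe] at hG hF ⊢
  exact mem_evalPart_comp.2 ⟨_, hF O hO a, hG O hO _⟩

theorem pair {F : (ℕ → ℕ) → α → β} {G : (ℕ → ℕ) → α → γ} (hF : UniformlyComputable S F)
    (hG : UniformlyComputable S G) : UniformlyComputable S fun O a => (F O a, G O a) := by
  obtain ⟨cF, hF⟩ := hF
  obtain ⟨cG, hG⟩ := hG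
  refine ⟨.pair cF cG, fun O hO a => ?_⟩
  simp only [← evalPart_coe] at hG hF ⊢
  exact mem_evalPart_pair.2 ⟨_, hF O hO a, _, hG O hO a, rfl⟩

theorem nat_rec {F : (ℕ → ℕ) → α → β} {G : (ℕ → ℕ) → α × ℕ × β → β}
    (hF : UniformlyComputable S F) (hG : UniformlyComputable S G) :
    UniformlyComputable S fun O (a : α × ℕ) =>
      Nat.rec (motive := fun _ => β) (F O a.1) (fun y b => G O (a.1, y, b)) a.2 := by
  obtain ⟨cF, hF⟩ := hF
  obtain ⟨cG, hG⟩ := hG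
  refine ⟨.prec cF cG, fun O hO ⟨a, k⟩ => ?_⟩
  simp only [← evalPart_coe] at hG hF ⊢
  induction k with
  | zero => exact mem_evalPart_prec_zero.2 (hF O hO a)
  | succ k ih => exact mem_evalPart_prec_succ.2 ⟨_, ih, hG O hO (a, k, _)⟩

theorem exists_find {P : (ℕ → ℕ) → α × ℕ → ℕ} (hP : UniformlyComputable S P)
    (h : ∀ O ∈ S, ∀ a, ∃ n, P O (a, n) = 0) :
    ∃ F : (ℕ → ℕ) → α → ℕ, UniformlyComputable S F ∧ ∀ O ∈ S, ∀ a, P O (a, F O a) = 0 := by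
  have hmem : ∀ O ∈ S, ∀ a, P O (a, sInf {n | P O (a, n) = 0}) = 0 :=
    fun O hO a => Nat.sInf_mem (h O hO a)
  refine ⟨fun O a => sInf {n | P O (a, n) = 0}, ?_, hmem⟩
  obtain ⟨cP, hP⟩ := hP
  refine ⟨.comp (.rfind' cP) (.pair (.pair .left .right) .zero), fun O hO a => ?_⟩
  simp only [← evalPart_coe] at hP ⊢
  refine mem_evalPart_comp.2 ⟨Nat.pair (encode a) 0, ?_, mem_evalPart_rfind'.2 ?_⟩
  · exact mem_evalPart_pair.2 ⟨_, mem_evalPart_pair.2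
      ⟨_, Part.mem_some _, _, Part.mem_some _, Nat.pair_unpair _⟩, 0, Part.mem_some _, rfl⟩
  · simp only [Nat.unpair_pair, Nat.add_zero]
    refine ⟨_, ⟨?_, fun i hi => ⟨_, hP O hO (a, i), ?_⟩⟩, rfl⟩
    · have := hP O hO (a, sInf {n | P O (a, n) = 0})
      rwa [hmem O hO a] at this
    · exact Nat.notMem_of_lt_sInf (s := {n | P O (a, n) = 0}) hi

theorem initSeg : UniformlyComputable S _root_.initSeg := by
  have h := nat_rec (S := S) (α := Unit) (β := List ℕ) (of_computable (Computable.const []))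
    (G := fun O a => a.2.2 ++ [O a.2.1]) <|
      (of_computable Computable.list_concat).comp <|
        (of_computable (Computable.snd.comp .snd)).pair <|
          oracle.comp (of_computable (Computable.fst.comp .snd))
  have h' := h.comp (of_computable (Computable.pair (Computable.const ()) Computable.id))
  convert h' using 3 with O n
  induction n with
  | zero => rfl
  | succ n ih => rw [initSeg_succ, ih]; rfl

end UniformlyComputable

theorem Partrec.exists_stages {α : Type*} [Primcodable α] {f : α →. ℕ} (hf : Partrec f) :
    ∃ E : ℕ → α → Option ℕ, Computable₂ E ∧ ∀ a m, m ∈ f a ↔ ∃ j, m ∈ E j a := by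
  obtain ⟨C, hC⟩ := Nat.Partrec.Code.exists_code.1 hf
  refine ⟨fun j a => C.evaln j (encode a), ?_, fun a m => ?_⟩
  · exact Nat.Partrec.Code.primrec_evaln.to_comp.comp
      (((Computable.fst.pair (Computable.const C))).pair (Computable.encode.comp .snd))
  · rw [← Nat.Partrec.Code.evaln_complete, hC]
    simp

/-- The oracle with stem `P` and, beyond it, the pointwise sum of `g` and the string `v`. -/
def overlay (P : List ℕ) (g : ℕ → ℕ) (v : List ℕ) (i : ℕ) : ℕ :=
  P[i]?.getD (g i + v[i]?.getD 0)

/-- The finite string of the overlay on the length of `v`, from a finite part `r` of the oracle. -/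
def overlayString (P r v : List ℕ) : List ℕ :=
  initSeg (overlay P (fun i => r[i]?.getD 0) v) v.length

theorem computable_overlayString (P : List ℕ) :
    Computable fun a : List ℕ × List ℕ => overlayString P a.1 a.2 := by
  unfold overlayString overlay
  simp only [initSeg_eq_map_range]
  refine (Primrec.list_map (Primrec.list_range.comp (Primrec.list_length.comp .snd)) ?_).to_comp
  refine Primrec.option_getD.comp (Primrec.list_getElem?.comp (.const P) .snd) ?_
  exact Primrec.nat_add.comp
    (Primrec.option_getD.comp (Primrec.list_getElem?.comp (Primrec.fst.comp .fst) .snd) (.const 0))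
    (Primrec.option_getD.comp (Primrec.list_getElem?.comp (Primrec.snd.comp .fst) .snd) (.const 0))

theorem getElem?_initSeg {f : ℕ → ℕ} {n i : ℕ} (h : i < n) : (initSeg f n)[i]? = some (f i) := by
  rw [initSeg_eq_map_range]
  simp [h]

theorem overlayString_initSeg (P : List ℕ) (g : ℕ → ℕ) (v : List ℕ) :
    overlayString P (initSeg g v.length) v = initSeg (overlay P g v) v.length := by
  refine initSeg_congr fun i hi => ?_
  simp [overlay, getElem?_initSeg hi]

theorem initSeg_overlay_of_prefix (P : List ℕ) (g : ℕ → ℕ) {v w : List ℕ} (h : v <+: w) :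
    initSeg (overlay P g v) v.length = initSeg (overlay P g w) v.length := by
  obtain ⟨u, rfl⟩ := h
  refine initSeg_congr fun i hi => ?_
  simp [overlay, List.getElem?_append_left hi]

/-- `X` extends the Hechler condition with stem `initSeg p k` and lower bound `p`. -/
def HechlerExtends (k : ℕ) (p X : ℕ → ℕ) : Prop :=
  (∀ i < k, X i = p i) ∧ ∀ i, p i ≤ X i

namespace HechlerExtends

variable {k k' : ℕ} {p q X g : ℕ → ℕ}

theorem refl (k : ℕ) (p : ℕ → ℕ) : HechlerExtends k p p :=
  ⟨fun _ _ => rfl, fun _ => le_rfl⟩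

theorem trans (h : HechlerExtends k p q) (h' : HechlerExtends k' q X) (hk : k ≤ k') :
    HechlerExtends k p X :=
  ⟨fun i hi => (h'.1 i (hi.trans_le hk)).trans (h.1 i hi), fun i => (h.2 i).trans (h'.2 i)⟩

theorem overlay (hg : ∀ x, p x ≤ g x) (k : ℕ) (v : List ℕ) :
    HechlerExtends k p (overlay (initSeg p k) g v) := by
  have key : ∀ i < k, _root_.overlay (initSeg p k) g v i = p i := fun i hi => by
    simp [_root_.overlay, getElem?_initSeg hi]
  refine ⟨key, fun i => ?_⟩
  by_cases hi : i < k
  · exact (key i hi).ge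
  · have : (initSeg p k)[i]? = none := by simpa [initSeg] using hi
    simpa [_root_.overlay, this] using (hg i).trans (Nat.le_add_right _ _)

end HechlerExtends

theorem exists_initSeg_overlay_append {p g Y : ℕ → ℕ} (k : ℕ) (v : List ℕ) (K : ℕ)
    (hv : v.length ≤ K) (hg : ∀ x, p x ≤ g x)
    (hY : HechlerExtends (max k v.length) (overlay (initSeg p k) g v) Y) :
    ∃ u, (v ++ u).length = K ∧ initSeg (overlay (initSeg p k) g (v ++ u)) K = initSeg Y K := by
  refine ⟨(initSeg (fun i => Y i - g i) K).drop v.length, ?_, initSeg_congr fun i hi => ?_⟩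
  · simp [initSeg, hv]
  · by_cases hik : i < k
    · rw [(HechlerExtends.overlay hg k _).1 i hik, hY.1 i (lt_max_of_lt_left hik),
        (HechlerExtends.overlay hg k _).1 i hik]
    · have hP : (initSeg p k)[i]? = none := by simpa [initSeg] using hik
      by_cases hiv : i < v.length
      · rw [hY.1 i (lt_max_of_lt_right hiv)]
        simp [overlay, List.getElem?_append_left hiv]
      · have h1 := hY.2 i
        rw [not_lt] at hiv
        simp only [overlay, hP, List.getElem?_append_right hiv, List.getElem?_drop,
          Nat.add_sub_cancel' hiv, getElem?_initSeg hi, Option.getD_some, Option.getD_none,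
          List.getElem?_eq_none hiv] at h1 ⊢
        omega

/-- If convergence of the functional is dense below a Hechler condition and no extension of the
condition takes it off the tree, then searching above an arbitrary majorizing function for
successive extensions with convergent values computes a path. -/
theorem exists_code_of_hechler_forces (t : List ℕ → Bool) (c : OracleCode) (k : ℕ) (p : ℕ → ℕ)
    (hT : ∀ X, HechlerExtends k p X → ∀ (h : ℕ → ℕ) N, (∀ j < N, h j ∈ c.eval X j) →
      t (initSeg h N) = true)
    (hD : ∀ X, HechlerExtends k p X → ∀ k' ≥ k, ∀ n,
      ∃ Y, HechlerExtends k' X Y ∧ (c.eval Y n).Dom) :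
    ∃ c' : OracleCode, ∀ g : ℕ → ℕ, (∀ x, p x ≤ g x) →
      ∃ h : ℕ → ℕ, (∀ n, t (initSeg h n) = true) ∧ ∀ n, c'.eval g n = Part.some (h n) := by
  obtain ⟨E, hE, hEmem⟩ := c.partrec_evalString.exists_stages
  set P := initSeg p k
  set S : Set (ℕ → ℕ) := {g | ∀ x, p x ≤ g x}
  let D : ℕ → List ℕ × ℕ := fun s => (decode s).getD ([], 0)
  have hDc : Computable D := Computable.option_getD Computable.decode (Computable.const _)
  let V : (List ℕ × ℕ) × ℕ → List ℕ := fun a => a.1.1 ++ (D a.2).1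
  have hV : Computable V := Computable.list_append.comp (Computable.fst.comp .fst)
    (Computable.fst.comp (hDc.comp .snd))
  let W : (ℕ → ℕ) → (List ℕ × ℕ) × ℕ → Option ℕ := fun O a =>
    E (D a.2).2 (overlayString P (initSeg O (V a).length) (V a), a.1.2)
  have hW : UniformlyComputable S W := by
    have h1 : UniformlyComputable S fun O a => (a, initSeg O (V a).length) :=
      (UniformlyComputable.of_computable Computable.id).pair
        (UniformlyComputable.initSeg.comp
          (UniformlyComputable.of_computable (Computable.list_length.comp hV)))
    refine (UniformlyComputable.of_computable (f := fun b : ((List ℕ × ℕ) × ℕ) × List ℕ =>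
      E (D b.1.2).2 (overlayString P b.2 (V b.1), b.1.1.2)) ?_).comp h1
    exact hE.comp (Computable.snd.comp (hDc.comp (Computable.snd.comp .fst)))
      (((computable_overlayString P).comp (Computable.snd.pair (hV.comp .fst))).pair
        (Computable.snd.comp (Computable.fst.comp .fst)))
  have hfind : ∀ O ∈ S, ∀ a, ∃ s, (fun o : Option ℕ => cond o.isSome 0 1) (W O (a, s)) = 0 := by
    rintro g hg ⟨v, n⟩
    obtain ⟨Y, hY, hdom⟩ := hD _ (HechlerExtends.overlay hg k v) _ (le_max_left k v.length) n
    obtain ⟨m, hm⟩ := Part.dom_iff_mem.1 hdom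
    obtain ⟨K, hK, hvK⟩ := ((c.eventually_mem_evalString Y n m hm).and
      (Filter.eventually_ge_atTop v.length)).exists
    obtain ⟨u, rfl, hu⟩ := exists_initSeg_overlay_append k v K hvK hg hY
    rw [← hu, hEmem (_, n)] at hK
    obtain ⟨j, hj⟩ := hK
    refine ⟨encode (u, j), ?_⟩
    simp only [W, V, D, encodek, Option.getD_some, overlayString_initSeg]
    rw [Option.mem_def] at hj
    rw [hj]
    rfl
  obtain ⟨F, hF, hFmem⟩ := ((UniformlyComputable.of_computable
    (Primrec.cond Primrec.option_isSome (.const 0) (.const 1)).to_comp).comp hW).exists_find hfind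
  let G : (ℕ → ℕ) → Unit × ℕ × List ℕ × ℕ → List ℕ × ℕ := fun O a =>
    let b := ((a.2.2.1, a.2.1), F O (a.2.2.1, a.2.1))
    (V b, (W O b).getD 0)
  have hG : UniformlyComputable S G := by
    have h0 : UniformlyComputable S fun (_ : ℕ → ℕ) (a : Unit × ℕ × List ℕ × ℕ) =>
        (a.2.2.1, a.2.1) := .of_computable
      ((Computable.fst.comp (Computable.snd.comp .snd)).pair (Computable.fst.comp .snd))
    have h1 := h0.pair (hF.comp h0)
    exact ((UniformlyComputable.of_computable hV).comp h1).pair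
      ((UniformlyComputable.of_computable
        (Computable.option_getD Computable.id (Computable.const 0))).comp (hW.comp h1))
  let st : (ℕ → ℕ) → ℕ → List ℕ × ℕ := fun O n =>
    Nat.rec (motive := fun _ => List ℕ × ℕ) ([], 0) (fun y b => G O ((), y, b)) n
  have hst : UniformlyComputable S fun O n => (st O (n + 1)).2 :=
    (UniformlyComputable.of_computable Computable.snd).comp
      ((UniformlyComputable.nat_rec (α := Unit)
        (.of_computable (Computable.const ([], 0))) hG).comp
        (.of_computable ((Computable.const ()).pair Computable.succ)))
  obtain ⟨c', hc'⟩ := hst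
  refine ⟨c', fun g hg => ⟨fun n => (st g (n + 1)).2, fun N => ?_, fun n =>
    Part.eq_some_iff.2 (hc' g hg n)⟩⟩
  have hmem : ∀ n, (st g (n + 1)).2 ∈ c.evalString
      (initSeg (overlay P g (st g (n + 1)).1) (st g (n + 1)).1.length) n := by
    intro n
    have h := hFmem g hg ((st g n).1, n)
    obtain ⟨m, hm⟩ : ∃ m, W g (((st g n).1, n), F g ((st g n).1, n)) = some m := by
      cases hw : W g (((st g n).1, n), F g ((st g n).1, n)) with
      | none => simp [hw] at h
      | some m => exact ⟨m, rfl⟩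
    have hm2 : (st g (n + 1)).2 = m := by
      change (W g (((st g n).1, n), F g ((st g n).1, n))).getD 0 = m
      rw [hm]; rfl
    rw [hm2, hEmem (_, n)]
    refine ⟨(D (F g ((st g n).1, n))).2, ?_⟩
    rw [← overlayString_initSeg]
    exact hm
  have hpre : ∀ j, (st g j).1 <+: (st g (j + 1)).1 := fun j => List.prefix_append _ _
  refine hT _ (HechlerExtends.overlay hg k (st g N).1) _ N fun j hj => ?_
  have hjN : (st g (j + 1)).1 <+: (st g N).1 := by
    induction N, Nat.succ_le_of_lt hj using Nat.le_induction with
    | base => exact List.prefix_rfl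
    | succ N hN ih => exact (ih hN).trans (hpre N)
  have := hmem j
  rw [initSeg_overlay_of_prefix P g hjN] at this
  exact OracleCode.mem_eval_of_mem_evalString this

/-- Below any Hechler condition, a functional can be prevented from computing a path. -/
theorem exists_hechlerExtends_forces_not_computes (t : List ℕ → Bool)
    (hneg : ¬ ∃ (c : OracleCode) (f' : ℕ → ℕ), ∀ g : ℕ → ℕ, (∀ x, f' x ≤ g x) →
      ∃ h : ℕ → ℕ, (∀ n, t (initSeg h n) = true) ∧ ∀ n, c.eval g n = Part.some (h n))
    (c : OracleCode) (k : ℕ) (p : ℕ → ℕ) :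
    ∃ k' X, k < k' ∧ HechlerExtends k p X ∧ ∀ Y, HechlerExtends k' X Y →
      ¬ ∃ h : ℕ → ℕ, (∀ n, t (initSeg h n) = true) ∧ ∀ n, c.eval Y n = Part.some (h n) := by
  by_cases hT : ∀ X, HechlerExtends k p X → ∀ (h : ℕ → ℕ) N, (∀ j < N, h j ∈ c.eval X j) →
      t (initSeg h N) = true
  · by_cases hD : ∀ X, HechlerExtends k p X → ∀ k' ≥ k, ∀ n,
      ∃ Y, HechlerExtends k' X Y ∧ (c.eval Y n).Dom
    · obtain ⟨c', hc'⟩ := exists_code_of_hechler_forces t c k p hT hD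
      exact absurd ⟨c', p, hc'⟩ hneg
    · push Not at hD
      obtain ⟨X, hX, k', hk', n, hn⟩ := hD
      refine ⟨k' + 1, X, by omega, hX, fun Y hY ⟨h, _, hh⟩ => ?_⟩
      refine hn Y ((HechlerExtends.refl k' X).trans hY (Nat.le_succ k')) ?_
      rw [hh n]
      trivial
  · push Not at hT
    obtain ⟨X, hX, h, N, hN, ht⟩ := hT
    obtain ⟨K, hK, hkK⟩ := (((Filter.eventually_all_finite (Set.finite_lt_nat N)).2
      fun j hj => c.eventually_mem_evalString X j _ (hN j hj)).and
        (Filter.eventually_gt_atTop k)).exists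
    refine ⟨K, X, hkK, hX, fun Y hY ⟨h', ht', hh'⟩ => ht ?_⟩
    rw [← ht' N]
    congr 1
    refine initSeg_congr fun j hj => ?_
    have h1 := hK j hj
    rw [← initSeg_congr hY.1] at h1
    have h2 := OracleCode.mem_eval_of_mem_evalString h1
    rw [hh' j] at h2
    exact Part.mem_some_iff.1 h2

/-- let `𝒫` be the Π⁰₁ class of paths through the computable tree
`{l | t l = true}`, and let `f` be such that every function dominating `f`
computes an element of `𝒫`.  Then there are a Turing functional `Φ` (an oracle
code `c`) and a function `f'` such that for every `g` majorizing `f'`, `Φ^g` is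
total and is an element of `𝒫`. -/
theorem hechler_majorizing_functional (t : List ℕ → Bool) (hcomp : Computable t)
    (htree : ∀ l : List ℕ, t l = true → ∀ l' : List ℕ, l' <+: l → t l' = true)
    (f : ℕ → ℕ)
    (hyp : ∀ g : ℕ → ℕ, (∃ N, ∀ x ≥ N, f x ≤ g x) →
      ∃ h : ℕ → ℕ, (∀ n, t (initSeg h n) = true) ∧
        ∃ c : OracleCode, ∀ n, c.eval g n = Part.some (h n)) :
    ∃ (c : OracleCode) (f' : ℕ → ℕ), ∀ g : ℕ → ℕ, (∀ x, f' x ≤ g x) →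
      ∃ h : ℕ → ℕ, (∀ n, t (initSeg h n) = true) ∧
        ∀ n, c.eval g n = Part.some (h n) := by
  by_contra hneg
  obtain ⟨e, he⟩ := exists_surjective_nat OracleCode
  choose next ext hlt hext hforce using exists_hechlerExtends_forces_not_computes t hneg
  let cond : ℕ → ℕ × (ℕ → ℕ) := fun n =>
    Nat.rec (0, f) (fun i q => (next (e i) q.1 q.2, ext (e i) q.1 q.2)) n
  have hk : StrictMono fun n => (cond n).1 := strictMono_nat_of_lt_succ fun n => hlt _ _ _
  have hstep : ∀ i n, i ≤ n → HechlerExtends (cond i).1 (cond i).2 (cond n).2 := by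
    intro i n hin
    induction n, hin using Nat.le_induction with
    | base => exact .refl _ _
    | succ n hn ih => exact ih.trans (hext (e n) _ _) (hk.monotone hn)
  let g : ℕ → ℕ := fun x => (cond (x + 1)).2 x
  have hg : ∀ i, HechlerExtends (cond i).1 (cond i).2 g := by
    intro i
    have key : ∀ n x, x < (cond n).1 → g x = (cond n).2 x := by
      intro n x hx
      rcases le_total n (x + 1) with h | h
      · exact (hstep _ _ h).1 x hx
      · exact ((hstep _ _ h).1 x (hk.le_apply (x := x + 1))).symm
    refine ⟨key i, fun x => ?_⟩
    rw [key (max i (x + 1)) x ((Nat.lt_succ_self x).trans_le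
      ((le_max_right i (x + 1)).trans hk.le_apply))]
    exact (hstep i _ (le_max_left _ _)).2 x
  obtain ⟨h, ht, c, hc⟩ := hyp g ⟨0, fun x _ => (hg 0).2 x⟩
  obtain ⟨i, rfl⟩ := he c
  exact hforce (e i) _ _ g (hg (i + 1)) ⟨h, ht, hc⟩
end
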